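/- arXiv:1711.08814 — 3 statements merged into one kernel-verified Lean document; each statement's English description precedes it below -/
import Mathlib

section
/- Let R be a commutative ring, δ ∈ R, and A an associative unital R-algebra containing elements c₁, c₂, c₃ satisfying: (1) cᵢ² = δ·cᵢ for all i; (2) cᵢcⱼcᵢ + cⱼ = cᵢ + cⱼcᵢcⱼ for all i ≠ j; (3) cᵢcⱼcᵢ = cᵢc_kcᵢ whenever {i,j,k} = {1,2,3}; (4) cᵢcⱼc_kcᵢ = cᵢc_kcⱼcᵢ whenever {i,j,k} = {1,2,3}. Then the R-subalgebra of A generated by {c₁, c₂, c₃} equals the R-submodule of A spanned by the 20 elements 1, c₁, c₂, c₃, c₁c₂, c₂c₁, c₂c₃, c₃c₂, c₁c₃, c₃c₁, c₁c₂c₁, c₁c₂c₃, c₁c₃c₂, c₂c₁c₃, c₂c₃c₁, c₃c₁c₂, c₃c₂c₁, c₁c₂c₃c₁, c₂c₁c₃c₂, c₃c₁c₂c₃. -/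
/-- If `c₁, c₂, c₃` in an `R`-algebra satisfy relations (1)–(4), then the `R`-subalgebra
they generate coincides with the `R`-submodule spanned by the 20 listed monomials. -/
theorem stmt_1 (R : Type*) [CommRing R] (A : Type*) [Ring A] [Algebra R A]
    (δ : R) (c : Fin 3 → A)
    (h1 : ∀ i : Fin 3, c i * c i = δ • c i)
    (h2 : ∀ i j : Fin 3, i ≠ j → c i * c j * c i + c j = c i + c j * c i * c j)
    (h3 : ∀ i j k : Fin 3, i ≠ j → j ≠ k → i ≠ k → c i * c j * c i = c i * c k * c i)
    (h4 : ∀ i j k : Fin 3, i ≠ j → j ≠ k → i ≠ k →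
      c i * c j * c k * c i = c i * c k * c j * c i) :
    (Algebra.adjoin R {c 0, c 1, c 2} : Set A) =
      (Submodule.span R
        ({1, c 0, c 1, c 2,
          c 0 * c 1, c 1 * c 0, c 1 * c 2, c 2 * c 1, c 0 * c 2, c 2 * c 0,
          c 0 * c 1 * c 0,
          c 0 * c 1 * c 2, c 0 * c 2 * c 1, c 1 * c 0 * c 2,
          c 1 * c 2 * c 0, c 2 * c 0 * c 1, c 2 * c 1 * c 0,
          c 0 * c 1 * c 2 * c 0, c 1 * c 0 * c 2 * c 1, c 2 * c 0 * c 1 * c 2} : Set A)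
        : Set A) := by
  apply Set.Subset.antisymm
  swap
  · have g : ∀ i, c i ∈ Algebra.adjoin R {c 0, c 1, c 2} := by
      intro i
      apply Algebra.subset_adjoin
      fin_cases i <;> simp
    refine (Submodule.span_le (p := Subalgebra.toSubmodule
      (Algebra.adjoin R {c 0, c 1, c 2}))).2 ?_
    intro x hx
    simp only [Set.mem_insert_iff, Set.mem_singleton_iff] at hx
    show x ∈ Algebra.adjoin R {c 0, c 1, c 2}
    rcases hx with rfl | rfl | rfl | rfl | rfl | rfl | rfl | rfl | rfl | rfl | rfl | rfl | rfl |
      rfl | rfl | rfl | rfl | rfl | rfl | rfl <;>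
    (repeat' first | exact one_mem _ | exact g _ | apply mul_mem)
  obtain ⟨t, ht⟩ : ∃ t, c 0 * c 1 * c 0 = c 0 + t := ⟨c 0 * c 1 * c 0 - c 0, by abel⟩
  have q01 : c 1 * c 0 * c 1 = c 1 + t := by
    have := h2 0 1 (by decide)
    rw [ht, add_assoc] at this
    rw [← add_left_cancel this, add_comm]
  have q02 : c 0 * c 2 * c 0 = c 0 + t := by
    rw [← ht]; exact (h3 0 1 2 (by decide) (by decide) (by decide)).symm
  have q12 : c 1 * c 2 * c 1 = c 1 + t := by
    rw [← q01]; exact (h3 1 0 2 (by decide) (by decide) (by decide)).symm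
  have q20 : c 2 * c 0 * c 2 = c 2 + t := by
    have := h2 0 2 (by decide)
    rw [q02, add_assoc] at this
    rw [← add_left_cancel this, add_comm]
  have q21 : c 2 * c 1 * c 2 = c 2 + t := by
    rw [← q20]; exact (h3 2 0 1 (by decide) (by decide) (by decide)).symm
  have P : ∀ i j, i ≠ j → c i * (c j * c i) = c i + t := by
    intro i j hij
    rw [← mul_assoc]
    fin_cases i <;> fin_cases j <;> first | exact absurd rfl hij | assumption
  have L : ∀ i, c i * t = δ • t := by
    intro i
    obtain ⟨j, hj⟩ : ∃ j, i ≠ j := by fin_cases i <;> decide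
    have e : t = c i * (c j * c i) - c i := by rw [P i j hj]; abel
    rw [e, mul_sub, ← mul_assoc (c i) (c i), h1, smul_mul_assoc, smul_sub]
  have Rt : ∀ i, t * c i = δ • t := by
    intro i
    obtain ⟨j, hj⟩ : ∃ j, i ≠ j := by fin_cases i <;> decide
    have e : t = c i * (c j * c i) - c i := by rw [P i j hj]; abel
    rw [e, sub_mul, mul_assoc, mul_assoc, h1, mul_smul_comm, mul_smul_comm, smul_sub]
  have P' : ∀ i j, i ≠ j → ∀ x, c i * (c j * (c i * x)) = c i * x + t * x := by
    intro i j hij x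
    rw [← mul_assoc (c j), ← mul_assoc (c i), P i j hij, add_mul]
  have h1' : ∀ i x, c i * (c i * x) = δ • (c i * x) := by
    intro i x
    rw [← mul_assoc, h1, smul_mul_assoc]
  have Rt' : ∀ i x, t * (c i * x) = δ • (t * x) := by
    intro i x
    rw [← mul_assoc, Rt, smul_mul_assoc]
  have w0 : c 0 * (c 2 * (c 1 * c 0)) = c 0 * (c 1 * (c 2 * c 0)) := by
    simpa only [mul_assoc] using h4 0 2 1 (by decide) (by decide) (by decide)
  have w1 : c 1 * (c 2 * (c 0 * c 1)) = c 1 * (c 0 * (c 2 * c 1)) := by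
    simpa only [mul_assoc] using h4 1 2 0 (by decide) (by decide) (by decide)
  have w2 : c 2 * (c 1 * (c 0 * c 2)) = c 2 * (c 0 * (c 1 * c 2)) := by
    simpa only [mul_assoc] using h4 2 1 0 (by decide) (by decide) (by decide)
  have u0 : c 1 * (c 0 * (c 1 * (c 2 * c 0))) = c 1 * (c 2 * c 0) + t * (c 2 * c 0) :=
    P' 1 0 (by decide) _
  have u0' : c 2 * (c 0 * (c 1 * (c 2 * c 0))) = c 2 * (c 1 * c 0) + t * (c 1 * c 0) := by
    rw [← w0]; exact P' 2 0 (by decide) _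
  have u1' : c 2 * (c 1 * (c 0 * (c 2 * c 1))) = c 2 * (c 0 * c 1) + t * (c 0 * c 1) := by
    rw [← w1]; exact P' 2 1 (by decide) _
  have u2' : c 1 * (c 2 * (c 0 * (c 1 * c 2))) = c 1 * (c 0 * c 2) + t * (c 0 * c 2) := by
    rw [← w2]; exact P' 1 2 (by decide) _
  generalize hS : ({1, c 0, c 1, c 2,
          c 0 * c 1, c 1 * c 0, c 1 * c 2, c 2 * c 1, c 0 * c 2, c 2 * c 0,
          c 0 * c 1 * c 0,
          c 0 * c 1 * c 2, c 0 * c 2 * c 1, c 1 * c 0 * c 2,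
          c 1 * c 2 * c 0, c 2 * c 0 * c 1, c 2 * c 1 * c 0,
          c 0 * c 1 * c 2 * c 0, c 1 * c 0 * c 2 * c 1, c 2 * c 0 * c 1 * c 2} : Set A) = S
  have hmem : ∀ x ∈ S, x ∈ Submodule.span R S := fun x hx => Submodule.subset_span hx
  have hm := hmem
  simp only [← hS, Set.mem_insert_iff, Set.mem_singleton_iff, forall_eq_or_imp, forall_eq] at hm
  rw [hS] at hm
  simp only [mul_assoc] at hm
  obtain ⟨m1, m2, m3, m4, m5, m6, m7, m8, m9, m10, m11, m12, m13, m14, m15, m16, m17, m18, m19,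
    m20⟩ := hm
  have mt : t ∈ Submodule.span R S := by
    have e : t = c 0 * (c 1 * c 0) - c 0 := by rw [P 0 1 (by decide)]; abel
    rw [e]; exact sub_mem m11 m2
  have n01 : (0 : Fin 3) ≠ 1 := by decide
  have n02 : (0 : Fin 3) ≠ 2 := by decide
  have n12 : (1 : Fin 3) ≠ 2 := by decide
  have key : ∀ i, ∀ m ∈ Submodule.span R S, c i * m ∈ Submodule.span R S := by
    intro i m hm
    induction hm using Submodule.span_induction with
    | zero => simp
    | add x y _ _ hx hy => rw [mul_add]; exact add_mem hx hy
    | smul r x _ hx => rw [mul_smul_comm]; exact Submodule.smul_mem _ _ hx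
    | mem x hx =>
      simp only [← hS, Set.mem_insert_iff, Set.mem_singleton_iff] at hx
      have hi : i = 0 ∨ i = 1 ∨ i = 2 := by fin_cases i <;> simp
      rcases hi with rfl | rfl | rfl <;>
      rcases hx with rfl | rfl | rfl | rfl | rfl | rfl | rfl | rfl | rfl | rfl | rfl | rfl | rfl |
        rfl | rfl | rfl | rfl | rfl | rfl | rfl <;>
      (try simp only [mul_assoc, mul_one, w0, w1, w2, u0, u0', u1', u2', h1, h1', P _ _ n01,
        P _ _ n02, P _ _ n12, P _ _ n01.symm, P _ _ n02.symm, P _ _ n12.symm,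
        P' _ _ n01, P' _ _ n02, P' _ _ n12, P' _ _ n01.symm, P' _ _ n02.symm, P' _ _ n12.symm,
        Rt, Rt', L, mul_add]) <;>
      (repeat' first | assumption | apply add_mem | apply Submodule.smul_mem)
  have all : ∀ x ∈ Algebra.adjoin R {c 0, c 1, c 2}, ∀ m ∈ Submodule.span R S,
      x * m ∈ Submodule.span R S := by
    intro x hx
    induction hx using Algebra.adjoin_induction with
    | mem x hx =>
      simp only [Set.mem_insert_iff, Set.mem_singleton_iff] at hx
      rcases hx with rfl | rfl | rfl <;> exact key _
    | algebraMap r =>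
      intro m hm
      rw [← Algebra.smul_def]; exact Submodule.smul_mem _ _ hm
    | add x y _ _ hx hy =>
      intro m hm
      rw [add_mul]; exact add_mem (hx m hm) (hy m hm)
    | mul x y _ _ hx hy =>
      intro m hm
      rw [mul_assoc]; exact hx _ (hy m hm)
  intro x hx
  have := all x hx 1 m1
  rwa [mul_one] at this
end

section
/- Let R be a commutative ring, δ ∈ R, and A an associative unital R-algebra containing elements c₁, c₂, c₃ satisfying: (1) cᵢ² = δ·cᵢ for all i; (2) cᵢcⱼcᵢ + cⱼ = cᵢ + cⱼcᵢcⱼ for all i ≠ j; (3) cᵢcⱼcᵢ = cᵢc_kcᵢ whenever {i,j,k} = {1,2,3}. Then whenever {i,j,ℓ} = {1,2,3} one has cᵢcⱼcᵢc_ℓ = cᵢc_ℓ + δ·(c_ℓcᵢc_ℓ − c_ℓ). -/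
/-- Given `c₁, c₂, c₃` in an `R`-algebra satisfying relations (1), (2) and (3), one has
`cᵢcⱼcᵢc_ℓ = cᵢc_ℓ + δ·(c_ℓcᵢc_ℓ - c_ℓ)` whenever `{i, j, ℓ} = {1, 2, 3}`. -/
theorem stmt_9 (R : Type*) [CommRing R] (A : Type*) [Ring A] [Algebra R A]
    (δ : R) (c : Fin 3 → A)
    (h1 : ∀ i : Fin 3, c i * c i = δ • c i)
    (h2 : ∀ i j : Fin 3, i ≠ j → c i * c j * c i + c j = c i + c j * c i * c j)
    (h3 : ∀ i j k : Fin 3, i ≠ j → j ≠ k → i ≠ k → c i * c j * c i = c i * c k * c i) :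
    ∀ i j l : Fin 3, i ≠ j → j ≠ l → i ≠ l →
      c i * c j * c i * c l = c i * c l + δ • (c l * c i * c l - c l) := by
  intro i j l hij hjl hil
  have e : c i * c l * c i = c i + c l * c i * c l - c l :=
    eq_sub_of_add_eq (h2 i l hil)
  rw [h3 i j l hij hjl hil, e, sub_mul, add_mul, mul_assoc (c l * c i), h1 l, mul_smul_comm,
    smul_sub, add_sub_assoc]
end

section
/- Let R be a commutative ring, δ ∈ R, and A an associative unital R-algebra containing elements c₁, c₂, c₃ satisfying: (1) cᵢ² = δ·cᵢ for all i; (2) cᵢcⱼcᵢ + cⱼ = cᵢ + cⱼcᵢcⱼ for all i ≠ j; (3) cᵢcⱼcᵢ = cᵢc_kcᵢ whenever {i,j,k} = {1,2,3}. Then whenever {i,j,k} = {1,2,3} one has cᵢcⱼc_kcᵢc_k = cᵢcⱼc_k + δ·(cᵢc_kcⱼc_k − cᵢc_k). -/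
/-- Given `c₁, c₂, c₃` in an `R`-algebra satisfying relations (1), (2) and (3), one has
`cᵢcⱼc_kcᵢc_k = cᵢcⱼc_k + δ·(cᵢc_kcⱼc_k - cᵢc_k)` whenever `{i, j, k} = {1, 2, 3}`. -/
theorem stmt_10 (R : Type*) [CommRing R] (A : Type*) [Ring A] [Algebra R A]
    (δ : R) (c : Fin 3 → A)
    (h1 : ∀ i : Fin 3, c i * c i = δ • c i)
    (h2 : ∀ i j : Fin 3, i ≠ j → c i * c j * c i + c j = c i + c j * c i * c j)
    (h3 : ∀ i j k : Fin 3, i ≠ j → j ≠ k → i ≠ k → c i * c j * c i = c i * c k * c i) :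
    ∀ i j k : Fin 3, i ≠ j → j ≠ k → i ≠ k →
      c i * c j * c k * c i * c k =
        c i * c j * c k + δ • (c i * c k * c j * c k - c i * c k) := by
  intro i j k hij hjk hik
  have e3 := h3 k i j hik.symm hij hjk.symm
  have e2 : c j * c k * c j = c k * c j * c k + c j - c k := by
    rw [eq_sub_iff_add_eq, h2 j k hjk, add_comm]
  calc c i * c j * c k * c i * c k = c i * c j * (c k * c i * c k) := by
        simp only [mul_assoc]
    _ = c i * (c j * c k * c j) * c k := by
        rw [e3]; simp only [mul_assoc]
    _ = c i * c k * c j * (c k * c k) + c i * c j * c k - c i * (c k * c k) := by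
        rw [e2]; noncomm_ring
    _ = _ := by
        rw [h1 k]
        simp only [mul_smul_comm, smul_sub]
        abel
end
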